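/- The generating function for the number of permutations of length n avoiding both 132 and 213 and containing the increasing pattern (1,2,…,k) exactly once is x^k(1−x)²/(1−2x+x^k)². -/

import Mathlib

/-- An occurrence of the pattern `τ` (of length `k`) in the permutation `π` (of length `n`)
is a strictly increasing map of positions along which `π` is order-isomorphic to `τ`. -/
def IsOcc {k n : ℕ} (τ : Fin k → Fin k) (π : Fin n → Fin n) (f : Fin k → Fin n) : Prop :=
  StrictMono f ∧ ∀ i j : Fin k, τ i < τ j ↔ π (f i) < π (f j)

/-- `π` avoids the pattern `τ`. -/
def Avoids {k n : ℕ} (τ : Fin k → Fin k) (π : Fin n → Fin n) : Prop :=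
  ¬ ∃ f, IsOcc τ π f

/-- `π` contains exactly one occurrence of the pattern `τ`. -/
def ContainsOnce {k n : ℕ} (τ : Fin k → Fin k) (π : Fin n → Fin n) : Prop :=
  ∃! f, IsOcc τ π f

def p123 : Fin 3 → Fin 3 := ![0, 1, 2]
def p132 : Fin 3 → Fin 3 := ![0, 2, 1]
def p213 : Fin 3 → Fin 3 := ![1, 0, 2]
def p231 : Fin 3 → Fin 3 := ![1, 2, 0]
def p312 : Fin 3 → Fin 3 := ![2, 0, 1]
def p321 : Fin 3 → Fin 3 := ![2, 1, 0]

theorem avoids_p132_iff {n : ℕ} (π : Fin n → Fin n) :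
    Avoids p132 π ↔ ∀ a b c, a < b → b < c → π a < π c → ¬ π c < π b := by
  constructor
  · intro h a b c hab hbc hac hcb
    refine h ⟨![a, b, c], ?_, ?_⟩
    · intro i j hij
      fin_cases i <;> fin_cases j <;> simp_all; order
    · intro i j
      fin_cases i <;> fin_cases j <;> simp [p132] <;> order
  · rintro h ⟨f, hf, h'⟩
    exact h (f 0) (f 1) (f 2) (hf (by decide)) (hf (by decide))
      ((h' 0 2).1 (by decide)) ((h' 2 1).1 (by decide))

theorem avoids_p213_iff {n : ℕ} (π : Fin n → Fin n) :
    Avoids p213 π ↔ ∀ a b c, a < b → b < c → π b < π a → ¬ π a < π c := by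
  constructor
  · intro h a b c hab hbc hac hcb
    refine h ⟨![a, b, c], ?_, ?_⟩
    · intro i j hij
      fin_cases i <;> fin_cases j <;> simp_all; order
    · intro i j
      fin_cases i <;> fin_cases j <;> simp [p213] <;> order
  · rintro h ⟨f, hf, h'⟩
    exact h (f 0) (f 1) (f 2) (hf (by decide)) (hf (by decide))
      ((h' 1 0).1 (by decide)) ((h' 0 2).1 (by decide))

theorem isOcc_id_iff {k n : ℕ} (π : Fin n → Fin n) (f : Fin k → Fin n) :
    IsOcc (fun i : Fin k => i) π f ↔ StrictMono f ∧ StrictMono (π ∘ f) := by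
  refine and_congr_right fun _ => ⟨fun h i j hij => (h i j).1 hij, fun h i j => h.lt_iff_lt.symm⟩

/-- Bijections of `Fin n` avoiding `132` and `213`. -/
def IsReverseLayered {n : ℕ} (π : Fin n → Fin n) : Prop :=
  Function.Bijective π ∧ Avoids p132 π ∧ Avoids p213 π

/-- The number of increasing subsequences of length `k`. -/
noncomputable def incCount (k : ℕ) {n : ℕ} (π : Fin n → Fin n) : ℕ :=
  Nat.card {f : Fin k → Fin n // IsOcc (fun i : Fin k => i) π f}

/-- The skew sum of the increasing permutation of length `n - p` and `ρ`. -/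
def skewSum {n p : ℕ} (hp : p ≤ n) (ρ : Fin p → Fin p) (i : Fin n) : Fin n :=
  if h : i.1 < n - p then ⟨p + i, by omega⟩ else ⟨ρ ⟨i - (n - p), by omega⟩, by omega⟩

/-- The embedding of the positions of `ρ` into those of `skewSum hp ρ`. -/
def tailPos {n p : ℕ} (hp : p ≤ n) (i : Fin p) : Fin n := ⟨n - p + i, by omega⟩

section skewSum

variable {n p : ℕ} (hp : p ≤ n) (ρ : Fin p → Fin p)

theorem skewSum_val_of_lt {i : Fin n} (h : i.1 < n - p) : (skewSum hp ρ i).1 = p + i := by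
  simp [skewSum, h]

theorem skewSum_tailPos (i : Fin p) : (skewSum hp ρ (tailPos hp i)).1 = ρ i := by
  simp [skewSum, tailPos]

theorem skewSum_val_cases (i : Fin n) :
    i.1 < n - p ∧ (skewSum hp ρ i).1 = p + i ∨ n - p ≤ i.1 ∧ (skewSum hp ρ i).1 < p := by
  by_cases h : i.1 < n - p <;> simp [skewSum, h]
  omega

theorem lt_or_eq_tailPos (i : Fin n) : i.1 < n - p ∨ ∃ j, i = tailPos hp j := by
  by_cases h : i.1 < n - p
  · exact .inl h
  · exact .inr ⟨⟨i - (n - p), by omega⟩, by ext; simp [tailPos]; omega⟩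

theorem tailPos_lt_tailPos {i j : Fin p} : tailPos hp i < tailPos hp j ↔ i < j := by
  simp only [tailPos, Fin.lt_def]; omega

theorem skewSum_tailPos_lt {i j : Fin p} :
    skewSum hp ρ (tailPos hp i) < skewSum hp ρ (tailPos hp j) ↔ ρ i < ρ j := by
  simp only [Fin.lt_def, skewSum_tailPos]

theorem skewSum_injective_iff :
    Function.Injective (skewSum hp ρ) ↔ Function.Injective ρ := by
  constructor
  · intro h i j hij
    have := @h (tailPos hp i) (tailPos hp j) (by ext; simp [skewSum_tailPos, hij])
    simpa [tailPos, Fin.ext_iff] using this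
  · intro h i j hij
    rw [Fin.ext_iff] at hij ⊢
    rcases lt_or_eq_tailPos hp i with hi | ⟨i, rfl⟩ <;>
    rcases lt_or_eq_tailPos hp j with hj | ⟨j, rfl⟩
    · rw [skewSum_val_of_lt hp ρ hi, skewSum_val_of_lt hp ρ hj] at hij; omega
    · rw [skewSum_val_of_lt hp ρ hi, skewSum_tailPos] at hij; omega
    · rw [skewSum_val_of_lt hp ρ hj, skewSum_tailPos] at hij; omega
    · rw [skewSum_tailPos, skewSum_tailPos] at hij
      rw [h (Fin.ext hij)]

theorem avoids_p132_skewSum_iff : Avoids p132 (skewSum hp ρ) ↔ Avoids p132 ρ := by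
  rw [avoids_p132_iff, avoids_p132_iff]
  constructor
  · intro h a b c hab hbc hac hcb
    exact h (tailPos hp a) (tailPos hp b) (tailPos hp c) ((tailPos_lt_tailPos hp).2 hab)
      ((tailPos_lt_tailPos hp).2 hbc) ((skewSum_tailPos_lt hp ρ).2 hac)
      ((skewSum_tailPos_lt hp ρ).2 hcb)
  · intro h a b c hab hbc hac hcb
    have ha := skewSum_val_cases hp ρ a
    have hb := skewSum_val_cases hp ρ b
    have hc := skewSum_val_cases hp ρ c
    simp only [Fin.lt_def] at hab hbc hac hcb
    obtain ⟨a, rfl⟩ := (lt_or_eq_tailPos hp a).resolve_left (by omega)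
    obtain ⟨b, rfl⟩ := (lt_or_eq_tailPos hp b).resolve_left (by omega)
    obtain ⟨c, rfl⟩ := (lt_or_eq_tailPos hp c).resolve_left (by omega)
    exact h a b c ((tailPos_lt_tailPos hp).1 hab) ((tailPos_lt_tailPos hp).1 hbc)
      ((skewSum_tailPos_lt hp ρ).1 hac) ((skewSum_tailPos_lt hp ρ).1 hcb)

theorem avoids_p213_skewSum_iff : Avoids p213 (skewSum hp ρ) ↔ Avoids p213 ρ := by
  rw [avoids_p213_iff, avoids_p213_iff]
  constructor
  · intro h a b c hab hbc hac hcb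
    exact h (tailPos hp a) (tailPos hp b) (tailPos hp c) ((tailPos_lt_tailPos hp).2 hab)
      ((tailPos_lt_tailPos hp).2 hbc) ((skewSum_tailPos_lt hp ρ).2 hac)
      ((skewSum_tailPos_lt hp ρ).2 hcb)
  · intro h a b c hab hbc hac hcb
    have ha := skewSum_val_cases hp ρ a
    have hb := skewSum_val_cases hp ρ b
    have hc := skewSum_val_cases hp ρ c
    simp only [Fin.lt_def] at hab hbc hac hcb
    obtain ⟨a, rfl⟩ := (lt_or_eq_tailPos hp a).resolve_left (by omega)
    obtain ⟨b, rfl⟩ := (lt_or_eq_tailPos hp b).resolve_left (by omega)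
    obtain ⟨c, rfl⟩ := (lt_or_eq_tailPos hp c).resolve_left (by omega)
    exact h a b c ((tailPos_lt_tailPos hp).1 hab) ((tailPos_lt_tailPos hp).1 hbc)
      ((skewSum_tailPos_lt hp ρ).1 hac) ((skewSum_tailPos_lt hp ρ).1 hcb)

theorem isReverseLayered_skewSum_iff :
    IsReverseLayered (skewSum hp ρ) ↔ IsReverseLayered ρ := by
  rw [IsReverseLayered, IsReverseLayered, avoids_p132_skewSum_iff, avoids_p213_skewSum_iff,
    ← Finite.injective_iff_bijective, ← Finite.injective_iff_bijective, skewSum_injective_iff]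

theorem incCount_skewSum {k : ℕ} (hk : 1 ≤ k) :
    incCount k (skewSum hp ρ) = (n - p).choose k + incCount k ρ := by
  have hcard : Nat.card (Fin k ↪o Fin (n - p)) = (n - p).choose k := by
    rw [Nat.card_congr Set.powersetCard.ofFinEmbEquiv, Set.powersetCard.card, Nat.card_fin]
  have : Finite (Fin k ↪o Fin (n - p)) := Finite.of_equiv _ Set.powersetCard.ofFinEmbEquiv.symm
  rw [incCount, incCount, ← hcard, ← Nat.card_sum]
  symm
  refine Nat.card_congr (Equiv.ofBijective (Sum.elim
    (fun g => ⟨fun i => Fin.castLE (Nat.sub_le n p) (g i), ?_⟩)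
    (fun g => ⟨fun i => tailPos hp (g.1 i), ?_⟩)) ⟨?_, ?_⟩)
  · rw [isOcc_id_iff]
    refine ⟨fun i j hij => by simpa using hij, fun i j hij => ?_⟩
    have := g.strictMono hij
    rw [Fin.lt_def, Function.comp, Function.comp, skewSum_val_of_lt hp ρ (by simp),
      skewSum_val_of_lt hp ρ (by simp)]
    simpa using this
  · have := (isOcc_id_iff _ _).1 g.2
    rw [isOcc_id_iff]
    exact ⟨fun i j hij => (tailPos_lt_tailPos hp).2 (this.1 hij),
      fun i j hij => (skewSum_tailPos_lt hp ρ).2 (this.2 hij)⟩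
  · have hne : ∀ (g : Fin k ↪o Fin (n - p)) (g' : Fin k → Fin p),
        (fun i => Fin.castLE (Nat.sub_le n p) (g i)) ≠ fun i => tailPos hp (g' i) := by
      intro g g' h
      have := congrArg Fin.val (congrFun h ⟨0, hk⟩)
      simp only [Fin.val_castLE, tailPos] at this
      omega
    rintro (g | g) (g' | g') h <;> simp only [Sum.elim_inl, Sum.elim_inr, Subtype.mk.injEq] at h
    · congr 1
      ext i
      simpa [Fin.ext_iff] using congrFun h i
    · exact (hne _ _ h).elim
    · exact (hne _ _ h.symm).elim
    · congr 1
      ext i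
      simpa [Fin.ext_iff, tailPos] using congrFun h i
  · rintro ⟨f, hf⟩
    obtain ⟨hf1, hf2⟩ := (isOcc_id_iff _ _).1 hf
    by_cases h0 : (f ⟨0, hk⟩).1 < n - p
    · have hlt : ∀ i, (f i).1 < n - p := by
        intro i
        obtain rfl | hi := eq_or_ne i ⟨0, hk⟩
        · exact h0
        have := hf2 (show ⟨0, hk⟩ < i by rw [Fin.lt_def]; simp [Fin.ext_iff] at hi; simp; omega)
        rw [Fin.lt_def, Function.comp, Function.comp, skewSum_val_of_lt hp ρ h0] at this
        have := skewSum_val_cases hp ρ (f i)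
        omega
      exact ⟨.inl (OrderEmbedding.ofStrictMono (fun i => ⟨f i, hlt i⟩) fun i j hij => hf1 hij), rfl⟩
    · have htail : ∀ i, ∃ j, f i = tailPos hp j := by
        intro i
        refine (lt_or_eq_tailPos hp (f i)).resolve_left fun h => h0 (lt_of_le_of_lt ?_ h)
        exact hf1.monotone (Nat.zero_le i.1)
      choose g hg using htail
      obtain rfl : f = fun i => tailPos hp (g i) := funext hg
      exact ⟨.inr ⟨g, (isOcc_id_iff _ _).2 ⟨fun i j hij => (tailPos_lt_tailPos hp).1 (hf1 hij),
        fun i j hij => (skewSum_tailPos_lt hp ρ).1 (hf2 hij)⟩⟩, rfl⟩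

end skewSum

theorem exists_eq_skewSum {n : ℕ} {π : Fin (n + 1) → Fin (n + 1)} (h : IsReverseLayered π) :
    ∃ (p : Fin (n + 1)) (ρ : Fin p → Fin p), skewSum p.2.le ρ = π := by
  obtain ⟨hπ, h1, h2⟩ := h
  rw [avoids_p132_iff] at h1
  rw [avoids_p213_iff] at h2
  have key : ∀ (m : ℕ) (hm : m < n + 1), m < n + 1 - (π 0).1 →
      (π ⟨m, hm⟩).1 = (π 0).1 + m := by
    intro m
    induction m using Nat.strong_induction_on with
    | _ m ih =>
      intro hm hmp
      obtain rfl | hm0 := Nat.eq_zero_or_pos m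
      · rfl
      obtain ⟨q, hq⟩ := hπ.2 ⟨(π 0).1 + m, by omega⟩
      have hq' : (π q).1 = (π 0).1 + m := by rw [hq]
      have hmq : m ≤ q.1 := by
        by_contra! hlt
        have := ih q.1 hlt q.2 (by omega)
        simp only [Fin.eta] at this
        omega
      obtain heq | hlt := hmq.eq_or_lt
      · subst heq; exact hq'
      exfalso
      obtain hv | hv := lt_or_ge (π ⟨m, hm⟩).1 (π 0).1
      · exact h2 0 ⟨m, hm⟩ q (by simpa [Fin.lt_def]) (by simpa [Fin.lt_def]) hv
          (by rw [Fin.lt_def]; omega)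
      · refine h1 0 ⟨m, hm⟩ q (by simpa [Fin.lt_def]) (by simpa [Fin.lt_def])
          (by rw [Fin.lt_def]; omega) ?_
        rw [Fin.lt_def]
        by_contra! hle
        obtain hlt' | heq := lt_or_eq_of_le hle
        · have := ih ((π ⟨m, hm⟩).1 - (π 0).1) (by omega) (by omega) (by omega)
          have := hπ.1 (a₁ := ⟨(π ⟨m, hm⟩).1 - (π 0).1, by omega⟩) (a₂ := ⟨m, hm⟩)
            (by ext; omega)
          rw [Fin.ext_iff] at this
          simp only at this
          omega
        · have := hπ.1 (Fin.ext heq)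
          rw [Fin.ext_iff] at this
          simp only at this
          omega
  have hlt : ∀ i : Fin (π 0).1, (π (tailPos (π 0).2.le i)).1 < (π 0).1 := by
    intro i
    by_contra! hle
    have := key ((π (tailPos (π 0).2.le i)).1 - (π 0).1) (by omega) (by omega)
    have := hπ.1 (a₁ := ⟨(π (tailPos (π 0).2.le i)).1 - (π 0).1, by omega⟩)
      (a₂ := tailPos (π 0).2.le i) (by ext; omega)
    rw [Fin.ext_iff] at this
    have h3 : (tailPos (π 0).2.le i).1 = n + 1 - (π 0).1 + i := rfl
    simp only at this
    omega
  refine ⟨π 0, fun i => ⟨π (tailPos (π 0).2.le i), hlt i⟩, ?_⟩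
  ext i
  rcases lt_or_eq_tailPos (π 0).2.le i with hi | ⟨j, rfl⟩
  · rw [skewSum_val_of_lt _ _ hi, ← key i.1 i.2 hi]
  · rw [skewSum_tailPos]

/-- The number of `132`- and `213`-avoiding permutations of length `n` with exactly `m` increasing
subsequences of length `k`. -/
noncomputable def layeredCount (k m n : ℕ) : ℕ :=
  Nat.card {π : Fin n → Fin n // IsReverseLayered π ∧ incCount k π = m}

theorem layeredCount_succ {k : ℕ} (hk : 1 ≤ k) (m n : ℕ) :
    layeredCount k m (n + 1) = ∑ p : Fin (n + 1), Nat.card {ρ : Fin p → Fin p //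
      IsReverseLayered ρ ∧ (n + 1 - p).choose k + incCount k ρ = m} := by
  rw [layeredCount, ← Nat.card_sigma]
  symm
  refine Nat.card_congr (Equiv.ofBijective (fun x => ⟨skewSum x.1.2.le x.2.1, ?_⟩) ⟨?_, ?_⟩)
  · rw [isReverseLayered_skewSum_iff, incCount_skewSum _ _ hk]
    exact x.2.2
  · rintro ⟨p, ρ, h⟩ ⟨p', ρ', h'⟩ heq
    simp only [Subtype.mk.injEq] at heq
    obtain rfl : p = p' := by
      have := congrArg Fin.val (congrFun heq 0)
      rw [skewSum_val_of_lt _ _ (by simp; omega), skewSum_val_of_lt _ _ (by simp; omega)] at this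
      ext
      simpa using this
    congr 2
    ext i
    rw [← skewSum_tailPos p.2.le ρ i, heq, skewSum_tailPos]
  · rintro ⟨π, h, hm⟩
    obtain ⟨p, ρ, rfl⟩ := exists_eq_skewSum h
    rw [isReverseLayered_skewSum_iff] at h
    rw [incCount_skewSum _ _ hk] at hm
    exact ⟨⟨p, ρ, h, hm⟩, rfl⟩

theorem incCount_of_isEmpty {k : ℕ} (hk : 1 ≤ k) (π : Fin 0 → Fin 0) : incCount k π = 0 := by
  have : IsEmpty (Fin k → Fin 0) := ⟨fun f => (f ⟨0, hk⟩).elim0⟩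
  simp [incCount]

theorem isReverseLayered_of_isEmpty (π : Fin 0 → Fin 0) : IsReverseLayered π :=
  ⟨⟨fun i => i.elim0, fun i => i.elim0⟩, fun ⟨f, _⟩ => (f 0).elim0, fun ⟨f, _⟩ => (f 0).elim0⟩

theorem layeredCount_zero_zero {k : ℕ} (hk : 1 ≤ k) : layeredCount k 0 0 = 1 := by
  simp [layeredCount, incCount_of_isEmpty hk, isReverseLayered_of_isEmpty]

theorem layeredCount_one_zero {k : ℕ} (hk : 1 ≤ k) : layeredCount k 1 0 = 0 := by
  simp [layeredCount, incCount_of_isEmpty hk]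

theorem layeredCount_zero_succ {k : ℕ} (hk : 1 ≤ k) (n : ℕ) :
    layeredCount k 0 (n + 1) =
      ∑ p ∈ Finset.range (n + 1), if n + 1 - p < k then layeredCount k 0 p else 0 := by
  rw [layeredCount_succ hk, ← Fin.sum_univ_eq_sum_range
    (fun p => if n + 1 - p < k then layeredCount k 0 p else 0)]
  refine Finset.sum_congr rfl fun p _ => ?_
  split_ifs with h
  · simp [Nat.choose_eq_zero_of_lt h, layeredCount]
  · have := Nat.choose_pos (not_lt.1 h)
    have : ∀ x, (n + 1 - p.1).choose k + x ≠ 0 := by omega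
    simp only [this, and_false]
    simp

theorem layeredCount_one_succ {k : ℕ} (hk : 1 ≤ k) (n : ℕ) :
    layeredCount k 1 (n + 1) =
      ∑ p ∈ Finset.range (n + 1), ((if n + 1 - p < k then layeredCount k 1 p else 0) +
        if n + 1 - p = k then layeredCount k 0 p else 0) := by
  rw [layeredCount_succ hk, ← Fin.sum_univ_eq_sum_range
    (fun p => (if n + 1 - p < k then layeredCount k 1 p else 0) +
        if n + 1 - p = k then layeredCount k 0 p else 0)]
  refine Finset.sum_congr rfl fun p _ => ?_
  obtain h | h | h := lt_trichotomy (n + 1 - p.1) k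
  · simp [Nat.choose_eq_zero_of_lt h, layeredCount, h, h.ne]
  · simp [h, layeredCount]
  · have h1 := Nat.choose_le_choose k (show k + 1 ≤ n + 1 - p.1 from h)
    rw [Nat.choose_succ_self_right] at h1
    have : ∀ x, (n + 1 - p.1).choose k + x ≠ 1 := by omega
    simp only [this, and_false]
    simp [h.not_gt, h.ne']

section PowerSeries

open PowerSeries

/-- The generating function of the lengths smaller than `k` of an increasing block. -/
noncomputable def blockSeries (k : ℕ) : PowerSeries ℚ :=
  mk fun j => if 1 ≤ j ∧ j < k then 1 else 0

theorem one_sub_X_mul_one_sub_blockSeries {k : ℕ} (hk : 1 ≤ k) :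
    (1 - X) * (1 - blockSeries k) = 1 - 2 * X + X ^ k := by
  have : (1 - X) * blockSeries k = X - X ^ k := by
    ext n
    rw [sub_mul, one_mul]
    rcases n with _ | n
    · simp [blockSeries]
      omega
    · rw [map_sub, mul_comm, coeff_succ_mul_X, map_sub, coeff_X, coeff_X_pow]
      simp only [blockSeries, coeff_mk]
      split_ifs <;> first | omega | norm_num
  linear_combination -this

theorem coeff_succ_mul_of_coeff_zero_eq_zero {R : Type*} [Semiring R] (f : PowerSeries R)
    {g : PowerSeries R} (hg : coeff 0 g = 0) (n : ℕ) :
    coeff (n + 1) (f * g) = ∑ p ∈ Finset.range (n + 1), coeff p f * coeff (n + 1 - p) g := by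
  rw [coeff_mul, Finset.Nat.sum_antidiagonal_eq_sum_range_succ_mk, Finset.sum_range_succ]
  simp [hg]

theorem mk_layeredCount_zero {k : ℕ} (hk : 1 ≤ k) :
    (mk fun n => (layeredCount k 0 n : ℚ)) =
      1 + (mk fun n => (layeredCount k 0 n : ℚ)) * blockSeries k := by
  ext n
  rcases n with _ | n
  · simp [layeredCount_zero_zero hk, blockSeries]
  · rw [coeff_mk, layeredCount_zero_succ hk, map_add,
      coeff_succ_mul_of_coeff_zero_eq_zero _ (by simp [blockSeries]), coeff_one,
      if_neg n.succ_ne_zero, zero_add]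
    push_cast
    refine Finset.sum_congr rfl fun p hp => ?_
    rw [Finset.mem_range] at hp
    have : 1 ≤ n + 1 - p := by omega
    simp [blockSeries, this]

theorem mk_layeredCount_one {k : ℕ} (hk : 1 ≤ k) :
    (mk fun n => (layeredCount k 1 n : ℚ)) =
      (mk fun n => (layeredCount k 1 n : ℚ)) * blockSeries k +
        (mk fun n => (layeredCount k 0 n : ℚ)) * X ^ k := by
  have h0 : coeff 0 (X ^ k : PowerSeries ℚ) = 0 := by
    rw [coeff_X_pow, if_neg (by omega)]
  ext n
  rcases n with _ | n
  · rw [coeff_mk, layeredCount_one_zero hk, map_add, coeff_mul, coeff_mul]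
    simp only [Finset.Nat.antidiagonal_zero, Finset.sum_singleton, h0]
    simp [blockSeries]
  · rw [coeff_mk, layeredCount_one_succ hk, map_add,
      coeff_succ_mul_of_coeff_zero_eq_zero _ (by simp [blockSeries]),
      coeff_succ_mul_of_coeff_zero_eq_zero _ h0, ← Finset.sum_add_distrib]
    push_cast
    refine Finset.sum_congr rfl fun p hp => ?_
    rw [Finset.mem_range] at hp
    have : 1 ≤ n + 1 - p := by omega
    simp [blockSeries, coeff_X_pow, this]

end PowerSeries

theorem containsOnce_id_iff {k n : ℕ} (π : Fin n → Fin n) :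
    ContainsOnce (fun i : Fin k => i) π ↔ incCount k π = 1 := by
  rw [incCount, Nat.card_eq_one_iff_exists, ContainsOnce]
  constructor
  · rintro ⟨f, hf, h⟩
    exact ⟨⟨f, hf⟩, fun g => Subtype.ext (h g.1 g.2)⟩
  · rintro ⟨f, h⟩
    exact ⟨f.1, f.2, fun g hg => congrArg Subtype.val (h ⟨g, hg⟩)⟩

open PowerSeries in
/-- the generating function of `|Sₙ(132,213; (1,2,…,k))|` is
`x^k (1−x)² / (1−2x+x^k)²`. -/
theorem stmt11 (k : ℕ) (hk : 1 ≤ k) :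
    ((1 - 2 * X + X ^ k) ^ 2 : PowerSeries ℚ) *
      PowerSeries.mk (fun n =>
        (Nat.card {π : Fin n → Fin n // Function.Bijective π ∧
          Avoids p132 π ∧ Avoids p213 π ∧ ContainsOnce (fun i : Fin k => i) π} : ℚ)) =
      X ^ k * (1 - X) ^ 2 := by
  have hcount : ∀ n, Nat.card {π : Fin n → Fin n // Function.Bijective π ∧
      Avoids p132 π ∧ Avoids p213 π ∧ ContainsOnce (fun i : Fin k => i) π} =
        layeredCount k 1 n := by
    intro n
    simp only [containsOnce_id_iff, layeredCount, IsReverseLayered, and_assoc]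
  simp only [hcount]
  rw [← one_sub_X_mul_one_sub_blockSeries hk]
  linear_combination (1 - X) ^ 2 * (1 - blockSeries k) * mk_layeredCount_one hk +
    (1 - X) ^ 2 * X ^ k * mk_layeredCount_zero hk
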